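/- Identification of the Complier intent-to-treat effect under Weak Principal Ignorability combined with the exclusion restriction for Never Takers: assume randomization (Z independent of (X, D0, D1, Y0, Y1) with 0 < P(Z = true) < 1), monotonicity (D0 ≤ D1 pointwise), π_c := P(D0 = false, D1 = true) > 0, the exclusion restriction E[Y0 | D1 = false] = E[Y1 | D1 = false] (the term vanishing if P(D1 = false) = 0), and the weak ignorability condition that E[Y1 | σ(X) ⊔ σ(D0) ⊔ σ(D1)] = E[Y1 | σ(X) ⊔ σ(D1)] holds P-almost surely on {D1 = true}. Define π_a := E[1_{D0 = true} | σ(X)], π_cX := E[1_{D0 = false, D1 = true} | σ(X)], φ := π_cX / (π_cX + π_a) (arbitrary where the denominator vanishes), π_n := P(D1 = false), D := if Z then D1 else D0, and Y := if Z then Y1 else Y0. Then E[Y1 − Y0 | {D0 = false} ∩ {D1 = true}] = E[φ · Y1 · 1_{D1 = true}] / π_c − ( (π_c + π_n) · E[Y | {Z = false} ∩ {D = false}] − π_n · E[Y | {Z = true} ∩ {D = false}] ) / π_c, where the conditioning events on the right-hand side have positive probability. -/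

import Mathlib

open MeasureTheory ProbabilityTheory

/-- The conditional expectation is self-adjoint against bounded functions. -/
lemma integral_condExp_mul_eq_integral_mul_condExp
    {Ω : Type*} {m mΩ : MeasurableSpace Ω} {P : Measure Ω} [IsFiniteMeasure P] (hm : m ≤ mΩ)
    {f h : Ω → ℝ} (hf : Integrable f P) (hh : Integrable h P) {c : NNReal}
    (hc : ∀ᵐ ω ∂P, |h ω| ≤ c) :
    ∫ ω, (P[f | m]) ω * h ω ∂P = ∫ ω, f ω * (P[h | m]) ω ∂P := by
  have hc' : ∀ᵐ ω ∂P, |(P[h | m]) ω| ≤ c := ae_bdd_abs_condExp_of_ae_bdd_abs hc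
  have h₁ : P[P[f | m] * h | m] =ᵐ[P] P[f | m] * P[h | m] :=
    condExp_mul_of_stronglyMeasurable_left stronglyMeasurable_condExp
      (integrable_condExp.mul_bdd hh.aestronglyMeasurable (c := c) (by simpa using hc)) hh
  have h₂ : P[f * P[h | m] | m] =ᵐ[P] P[f | m] * P[h | m] :=
    condExp_mul_of_stronglyMeasurable_right stronglyMeasurable_condExp
      (hf.mul_bdd integrable_condExp.aestronglyMeasurable (c := c) (by simpa using hc')) hf
  calc ∫ ω, (P[f | m]) ω * h ω ∂P = ∫ ω, (P[P[f | m] * h | m]) ω ∂P := (integral_condExp hm).symm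
    _ = ∫ ω, (P[f * P[h | m] | m]) ω ∂P := integral_congr_ae (h₁.trans h₂.symm)
    _ = ∫ ω, f ω * (P[h | m]) ω ∂P := integral_condExp hm

/-- Conditional Bayes rule: given `X` and the indicator `D` of an event containing `C`, the
conditional probability of `C` is `P(C | X) / P(D = true | X)` on `{D = true}`, and `0` off it. -/
lemma condExp_indicator_sup_comap_ae_eq
    {Ω 𝒳 : Type*} {mΩ : MeasurableSpace Ω} {m𝒳 : MeasurableSpace 𝒳}
    {P : Measure Ω} [IsFiniteMeasure P] {X : Ω → 𝒳} {D : Ω → Bool} {C : Set Ω}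
    (hX : Measurable X) (hD : Measurable D) (hC : MeasurableSet C)
    (hCD : ∀ ω ∈ C, D ω = true) :
    P[C.indicator (fun _ => (1 : ℝ)) |
        MeasurableSpace.comap X m𝒳 ⊔ MeasurableSpace.comap D inferInstance]
      =ᵐ[P] fun ω => (P[C.indicator (fun _ => (1 : ℝ)) | MeasurableSpace.comap X m𝒳]) ω
        / (P[{ω | D ω = true}.indicator (fun _ => (1 : ℝ)) | MeasurableSpace.comap X m𝒳]) ω
        * {ω | D ω = true}.indicator (fun _ => (1 : ℝ)) ω := by
  set T : Set Ω := {ω | D ω = true}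
  set m := MeasurableSpace.comap X m𝒳 with hm_def
  set p := P[C.indicator (fun _ => (1 : ℝ)) | m]
  set q := P[T.indicator (fun _ => (1 : ℝ)) | m]
  have hm : m ≤ mΩ := hX.comap_le
  have hm' : m ⊔ MeasurableSpace.comap D inferInstance ≤ mΩ := sup_le hm hD.comap_le
  have hT : MeasurableSet[mΩ] T := hD (measurableSet_singleton true)
  have hCi : Integrable (C.indicator (fun _ => (1 : ℝ))) P := (integrable_const 1).indicator hC
  have hTi : Integrable (T.indicator (fun _ => (1 : ℝ))) P := (integrable_const 1).indicator hT
  have hp0 : 0 ≤ᵐ[P] p :=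
    condExp_nonneg (.of_forall fun ω => Set.indicator_nonneg (fun _ _ => zero_le_one) ω)
  have hpq : p ≤ᵐ[P] q := condExp_mono hCi hTi (.of_forall fun ω =>
    Set.indicator_le_indicator_of_subset hCD (fun _ => zero_le_one) ω)
  have hr1 : ∀ᵐ ω ∂P, ‖p ω / q ω‖ ≤ 1 := by
    filter_upwards [hp0, hpq] with ω h0 h1
    have h0' : 0 ≤ p ω := h0
    rw [Real.norm_of_nonneg (div_nonneg h0' (h0'.trans h1))]
    exact div_le_one_of_le₀ h1 (h0'.trans h1)
  have hrm : StronglyMeasurable[m] (fun ω => p ω / q ω) :=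
    (stronglyMeasurable_condExp.measurable.div
      stronglyMeasurable_condExp.measurable).stronglyMeasurable
  have hrTi : Integrable (fun ω => p ω / q ω * T.indicator (fun _ => (1 : ℝ)) ω) P :=
    hTi.bdd_mul (hrm.mono hm).aestronglyMeasurable hr1
  have hpull : P[fun ω => p ω / q ω * T.indicator (fun _ => (1 : ℝ)) ω | m] =ᵐ[P] p := by
    refine (condExp_mul_of_stronglyMeasurable_left hrm hrTi hTi).trans ?_
    filter_upwards [hp0, hpq] with ω h0 h1
    have h0' : 0 ≤ p ω := h0
    change p ω / q ω * q ω = p ω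
    exact div_mul_cancel_of_imp fun h => le_antisymm (h ▸ h1) h0'
  refine (ae_eq_condExp_of_forall_setIntegral_eq hm' hCi (fun s _ _ => hrTi.integrableOn)
    (fun s hs _ => ?_) ?_).symm
  · rw [hm_def, ← MeasurableSpace.comap_prodMk] at hs
    obtain ⟨U, hU, rfl⟩ := hs
    set B : Set Ω := X ⁻¹' {x | (x, true) ∈ U}
    have hB : MeasurableSet[m] B := ⟨_, measurable_prodMk_right hU, rfl⟩
    have key : ∀ f : Ω → ℝ, (∀ ω, ω ∉ T → f ω = 0) →
        ∫ ω in (fun ω => (X ω, D ω)) ⁻¹' U, f ω ∂P = ∫ ω in B, f ω ∂P := by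
      intro f hf
      rw [← integral_indicator (hX.prodMk hD hU), ← integral_indicator (hm _ hB)]
      congr 1
      ext ω
      by_cases hω : ω ∈ T
      · have hDω : D ω = true := hω
        have hiff : ω ∈ (fun ω => (X ω, D ω)) ⁻¹' U ↔ ω ∈ B := by
          change (X ω, D ω) ∈ U ↔ (X ω, true) ∈ U
          rw [hDω]
        by_cases hωB : ω ∈ B
        · rw [Set.indicator_of_mem hωB, Set.indicator_of_mem (hiff.2 hωB)]
        · rw [Set.indicator_of_notMem hωB, Set.indicator_of_notMem (hωB ∘ hiff.1)]
      · simp [Set.indicator, hf ω hω]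
    rw [key _ fun ω hω => by simp [hω], key _ fun ω hω => Set.indicator_of_notMem
      (fun h => hω (hCD ω h)) _, ← setIntegral_condExp hm hrTi hB, ← setIntegral_condExp hm hCi hB]
    exact setIntegral_congr_ae (hm _ hB) (hpull.mono fun ω h _ => h)
  · refine StronglyMeasurable.aestronglyMeasurable ?_
    have hDm : MeasurableSpace.comap D inferInstance ≤
        m ⊔ MeasurableSpace.comap D inferInstance := le_sup_right
    have hmm : m ≤ m ⊔ MeasurableSpace.comap D inferInstance := le_sup_left
    exact (hrm.mono hmm).mul
      (stronglyMeasurable_const.indicator (hDm _ ⟨{true}, measurableSet_singleton _, rfl⟩))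

lemma indicator_one_eq_ite {Ω : Type*} (p : Ω → Prop) [DecidablePred p] :
    {ω | p ω}.indicator (fun _ => (1 : ℝ)) = fun ω => if p ω then (1 : ℝ) else 0 := by
  ext ω
  by_cases h : p ω <;> simp [Set.indicator, h]

lemma integral_cond_eq {Ω : Type*} {mΩ : MeasurableSpace Ω} (P : Measure Ω) (s : Set Ω)
    (f : Ω → ℝ) : ∫ ω, f ω ∂(P[|s]) = (P.real s)⁻¹ * ∫ ω in s, f ω ∂P := by
  rw [ProbabilityTheory.cond, integral_smul_measure, ENNReal.toReal_inv, smul_eq_mul,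
    measureReal_def]

lemma measureReal_mul_integral_cond {Ω : Type*} {mΩ : MeasurableSpace Ω} (P : Measure Ω)
    [IsFiniteMeasure P] (s : Set Ω) (f : Ω → ℝ) :
    P.real s * ∫ ω, f ω ∂(P[|s]) = ∫ ω in s, f ω ∂P := by
  rw [integral_cond_eq]
  by_cases h : P.real s = 0
  · rw [setIntegral_measure_zero f ((measureReal_eq_zero_iff).1 h)]
    simp
  · rw [mul_inv_cancel_left₀ h]

/-- Conditioning further on an independent event of positive probability does not change a
conditional mean. -/
lemma integral_cond_inter_of_indepFun {Ω α β : Type*} {mΩ : MeasurableSpace Ω}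
    {mα : MeasurableSpace α} {mβ : MeasurableSpace β} {P : Measure Ω} [IsFiniteMeasure P]
    {Z : Ω → α} {W : Ω → β} (hZ : Measurable Z) (hW : Measurable W) (hZW : IndepFun Z W P)
    {s : Set α} (hs : MeasurableSet s) (hPs : P (Z ⁻¹' s) ≠ 0)
    {t : Set β} (ht : MeasurableSet t) {f : β → ℝ} (hf : Measurable f) :
    ∫ ω, f (W ω) ∂(P[|Z ⁻¹' s ∩ W ⁻¹' t]) = ∫ ω, f (W ω) ∂(P[|W ⁻¹' t]) := by
  have hI : ∫ ω in Z ⁻¹' s ∩ W ⁻¹' t, f (W ω) ∂P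
      = P.real (Z ⁻¹' s) * ∫ ω in W ⁻¹' t, f (W ω) ∂P := by
    have hφ : Measurable (s.indicator (fun _ => (1 : ℝ))) := measurable_const.indicator hs
    have hψ : Measurable (t.indicator f) := hf.indicator ht
    have := (hZW.comp hφ hψ).integral_fun_mul_eq_mul_integral
      (hφ.comp hZ).aestronglyMeasurable (hψ.comp hW).aestronglyMeasurable
    rw [← integral_indicator ((hZ hs).inter (hW ht)), ← integral_indicator (hW ht),
      ← integral_indicator_one (hZ hs)]
    refine Eq.trans (integral_congr_ae (.of_forall fun ω => ?_)) this
    by_cases h₁ : Z ω ∈ s <;> by_cases h₂ : W ω ∈ t <;> simp [Set.indicator, h₁, h₂]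
  have hne : P.real (Z ⁻¹' s) ≠ 0 := (measureReal_ne_zero_iff).2 hPs
  rw [integral_cond_eq, integral_cond_eq, hI, measureReal_def,
    hZW.measure_inter_preimage_eq_mul s t hs ht, ENNReal.toReal_mul, ← measureReal_def,
    ← measureReal_def, mul_inv, mul_mul_mul_comm, inv_mul_cancel₀ hne, one_mul]

/-- Identification of the Complier intent-to-treat effect under Weak Principal
Ignorability (treatment side) combined with the exclusion restriction for Never
Takers: `E[Y1 − Y0 | Complier]
  = E[φ·Y1·1_{D1}] / π_c
    − ((π_c + π_n)·E[Y | Z = false, D = false] − π_n·E[Y | Z = true, D = false]) / π_c`. -/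
theorem complier_itt_weak_PI_and_exclusion
    {Ω 𝒳 : Type*} {mΩ : MeasurableSpace Ω} {m𝒳 : MeasurableSpace 𝒳}
    (P : Measure Ω) [IsProbabilityMeasure P]
    (X : Ω → 𝒳) (D0 D1 Z : Ω → Bool) (Y0 Y1 : Ω → ℝ)
    (hX : Measurable X) (hD0 : Measurable D0) (hD1 : Measurable D1)
    (hZ : Measurable Z) (hY0m : Measurable Y0) (hY1m : Measurable Y1)
    (hY0 : Integrable Y0 P) (hY1 : Integrable Y1 P)
    (hindep : IndepFun Z (fun ω => (X ω, D0 ω, D1 ω, Y0 ω, Y1 ω)) P)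
    (hZpos : 0 < P {ω | Z ω = true}) (hZlt : P {ω | Z ω = true} < 1)
    (hmono : ∀ ω, D0 ω = true → D1 ω = true)
    (hcpos : 0 < P {ω | D0 ω = false ∧ D1 ω = true})
    (hexcl : (∫ ω, Y0 ω ∂(P[|{ω | D1 ω = false}]))
        = ∫ ω, Y1 ω ∂(P[|{ω | D1 ω = false}]))
    (hWPI : ∀ᵐ ω ∂P, D1 ω = true →
      (P[Y1 | MeasurableSpace.comap X m𝒳 ⊔ MeasurableSpace.comap D0 inferInstance
            ⊔ MeasurableSpace.comap D1 inferInstance]) ω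
        = (P[Y1 | MeasurableSpace.comap X m𝒳 ⊔ MeasurableSpace.comap D1 inferInstance]) ω) :
    let π_a := P[(fun ω => if D0 ω then (1 : ℝ) else 0) | MeasurableSpace.comap X m𝒳]
    let π_cX := P[(fun ω => if D0 ω = false ∧ D1 ω = true then (1 : ℝ) else 0) |
        MeasurableSpace.comap X m𝒳]
    let φ := fun ω => π_cX ω / (π_cX ω + π_a ω)
    (∫ ω, (Y1 ω - Y0 ω) ∂(P[|{ω | D0 ω = false} ∩ {ω | D1 ω = true}]))
      = (∫ ω, φ ω * Y1 ω * (if D1 ω then (1 : ℝ) else 0) ∂P)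
          / (P {ω | D0 ω = false ∧ D1 ω = true}).toReal
        - (((P {ω | D0 ω = false ∧ D1 ω = true}).toReal + (P {ω | D1 ω = false}).toReal)
              * (∫ ω, (if Z ω then Y1 ω else Y0 ω)
                  ∂(P[|{ω | Z ω = false} ∩ {ω | (if Z ω then D1 ω else D0 ω) = false}]))
            - (P {ω | D1 ω = false}).toReal
              * (∫ ω, (if Z ω then Y1 ω else Y0 ω)
                  ∂(P[|{ω | Z ω = true} ∩ {ω | (if Z ω then D1 ω else D0 ω) = false}])))
          / (P {ω | D0 ω = false ∧ D1 ω = true}).toReal := by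
  intro π_a π_cX φ
  set C : Set Ω := {ω | D0 ω = false ∧ D1 ω = true} with hC_def
  set T : Set Ω := {ω | D1 ω = true} with hT_def
  set N : Set Ω := {ω | D1 ω = false}
  set A : Set Ω := {ω | D0 ω = true} with hA_def
  have hD0s : ∀ b, MeasurableSet {ω | D0 ω = b} := fun b => hD0 (measurableSet_singleton b)
  have hD1s : ∀ b, MeasurableSet {ω | D1 ω = b} := fun b => hD1 (measurableSet_singleton b)
  have hZs : ∀ b, MeasurableSet {ω | Z ω = b} := fun b => hZ (measurableSet_singleton b)
  have hC : MeasurableSet C := (hD0s false).inter (hD1s true)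
  have hCi : Integrable (C.indicator (fun _ => (1 : ℝ))) P := (integrable_const 1).indicator hC
  have hAi : Integrable (A.indicator (fun _ => (1 : ℝ))) P :=
    (integrable_const 1).indicator (hD0s true)
  have hCN : Disjoint C N := Set.disjoint_left.2 fun ω h h' => by
    have h₁ : D1 ω = true := h.2
    have h₂ : D1 ω = false := h'
    simp [h₁] at h₂
  have hCN_eq : {ω | D0 ω = false} = C ∪ N := by
    ext ω
    have := hmono ω
    change D0 ω = false ↔ (D0 ω = false ∧ D1 ω = true) ∨ D1 ω = false
    cases h0 : D0 ω <;> cases h1 : D1 ω <;> simp_all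
  -- the treatment arm
  have hφT : P[C.indicator (fun _ => (1 : ℝ)) |
        MeasurableSpace.comap X m𝒳 ⊔ MeasurableSpace.comap D1 inferInstance]
      =ᵐ[P] fun ω => φ ω * (if D1 ω then (1 : ℝ) else 0) := by
    have hTsum : T.indicator (fun _ => (1 : ℝ))
        = C.indicator (fun _ => (1 : ℝ)) + A.indicator (fun _ => (1 : ℝ)) := by
      ext ω
      have := hmono ω
      cases h0 : D0 ω <;> cases h1 : D1 ω <;>
        simp_all [Set.indicator]
    have hπc : π_cX = P[C.indicator (fun _ => (1 : ℝ)) | MeasurableSpace.comap X m𝒳] :=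
      congrArg _ (indicator_one_eq_ite _).symm
    have hπa : π_a = P[A.indicator (fun _ => (1 : ℝ)) | MeasurableSpace.comap X m𝒳] :=
      congrArg _ (indicator_one_eq_ite _).symm
    have hadd := condExp_add hCi hAi (MeasurableSpace.comap X m𝒳)
    rw [← hTsum, ← hπc, ← hπa] at hadd
    have hB := condExp_indicator_sup_comap_ae_eq (P := P) hX hD1 hC fun ω h => h.2
    rw [← hπc] at hB
    filter_upwards [hB, hadd] with ω h h'
    have h'' : (P[{ω | D1 ω = true}.indicator (fun _ => (1 : ℝ)) |
        MeasurableSpace.comap X m𝒳]) ω = π_cX ω + π_a ω := h'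
    rw [h, h'']
    simp only [φ, Set.indicator, Set.mem_ofPred_eq]
  have hY1C : ∫ ω in C, Y1 ω ∂P
      = ∫ ω, φ ω * Y1 ω * (if D1 ω then (1 : ℝ) else 0) ∂P := by
    have hm₂ : MeasurableSpace.comap X m𝒳 ⊔ MeasurableSpace.comap D0 inferInstance
        ⊔ MeasurableSpace.comap D1 inferInstance ≤ mΩ :=
      sup_le (sup_le hX.comap_le hD0.comap_le) hD1.comap_le
    have hm₁ : MeasurableSpace.comap X m𝒳 ⊔ MeasurableSpace.comap D1 inferInstance ≤ mΩ :=
      sup_le hX.comap_le hD1.comap_le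
    have hC₂ : MeasurableSet[MeasurableSpace.comap X m𝒳 ⊔ MeasurableSpace.comap D0 inferInstance
        ⊔ MeasurableSpace.comap D1 inferInstance] C := by
      refine MeasurableSet.inter (s₁ := {ω | D0 ω = false}) (s₂ := {ω | D1 ω = true}) ?_ ?_
      · exact (le_sup_right.trans le_sup_left : MeasurableSpace.comap D0 inferInstance ≤ _) _
          ⟨{false}, measurableSet_singleton _, rfl⟩
      · exact (le_sup_right : MeasurableSpace.comap D1 inferInstance ≤ _) _
          ⟨{true}, measurableSet_singleton _, rfl⟩
    rw [← setIntegral_condExp hm₂ hY1 hC₂,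
      setIntegral_congr_ae hC (hWPI.mono fun ω h hω => h hω.2), ← integral_indicator hC]
    calc _ = ∫ ω, (P[Y1 | MeasurableSpace.comap X m𝒳
              ⊔ MeasurableSpace.comap D1 inferInstance]) ω
              * C.indicator (fun _ => (1 : ℝ)) ω ∂P := by
          refine integral_congr_ae (.of_forall fun ω => ?_)
          by_cases h : ω ∈ C <;> simp [h]
      _ = ∫ ω, Y1 ω * (P[C.indicator (fun _ => (1 : ℝ)) | MeasurableSpace.comap X m𝒳
              ⊔ MeasurableSpace.comap D1 inferInstance]) ω ∂P :=
          integral_condExp_mul_eq_integral_mul_condExp hm₁ hY1 hCi (c := 1)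
            (.of_forall fun ω => by by_cases h : ω ∈ C <;> simp [h])
      _ = _ := by
          refine integral_congr_ae (hφT.mono fun ω h => ?_)
          simp only [h]
          ring
  -- the two observed cells
  have hZt : P (Z ⁻¹' {true}) ≠ 0 := hZpos.ne'
  have hZf : P (Z ⁻¹' {false}) ≠ 0 := by
    intro h
    have hcompl : Z ⁻¹' {false} = {ω | Z ω = true}ᶜ := by
      ext ω
      change Z ω = false ↔ ¬ Z ω = true
      simp
    rw [hcompl, prob_compl_eq_zero_iff (hZs true)] at h
    exact hZlt.ne h
  have hW : Measurable fun ω => (X ω, D0 ω, D1 ω, Y0 ω, Y1 ω) := by fun_prop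
  have hcell0 : ∫ ω, (if Z ω then Y1 ω else Y0 ω)
        ∂(P[|{ω | Z ω = false} ∩ {ω | (if Z ω then D1 ω else D0 ω) = false}])
      = ∫ ω, Y0 ω ∂(P[|{ω | D0 ω = false}]) := by
    have hset : {ω | Z ω = false} ∩ {ω | (if Z ω then D1 ω else D0 ω) = false}
        = {ω | Z ω = false} ∩ {ω | D0 ω = false} := by
      ext ω
      change (Z ω = false ∧ (if Z ω then D1 ω else D0 ω) = false)
        ↔ (Z ω = false ∧ D0 ω = false)
      cases Z ω <;> simp
    rw [hset]
    refine Eq.trans (integral_congr_ae ?_) (integral_cond_inter_of_indepFun hZ hW hindep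
      (measurableSet_singleton false) hZf
      (t := {w | w.2.1 = false}) (measurable_snd.fst (measurableSet_singleton false))
      (f := fun w => w.2.2.2.1) (by fun_prop))
    refine (ae_cond_mem ((hZs false).inter (hD0s false))).mono fun ω hω => ?_
    have hω' : Z ω = false := hω.1
    simp [hω']
  have hcell1 : ∫ ω, (if Z ω then Y1 ω else Y0 ω)
        ∂(P[|{ω | Z ω = true} ∩ {ω | (if Z ω then D1 ω else D0 ω) = false}])
      = ∫ ω, Y1 ω ∂(P[|N]) := by
    have hset : {ω | Z ω = true} ∩ {ω | (if Z ω then D1 ω else D0 ω) = false}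
        = {ω | Z ω = true} ∩ N := by
      ext ω
      change (Z ω = true ∧ (if Z ω then D1 ω else D0 ω) = false)
        ↔ (Z ω = true ∧ D1 ω = false)
      cases Z ω <;> simp
    rw [hset]
    refine Eq.trans (integral_congr_ae ?_) (integral_cond_inter_of_indepFun hZ hW hindep
      (measurableSet_singleton true) hZt
      (t := {w | w.2.2.1 = false}) (measurable_snd.snd.fst (measurableSet_singleton false))
      (f := fun w => w.2.2.2.2) (by fun_prop))
    refine (ae_cond_mem ((hZs true).inter (hD1s false))).mono fun ω hω => ?_
    have hω' : Z ω = true := hω.1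
    simp [hω']
  have h0 : (P.real C + P.real N) * ∫ ω, Y0 ω ∂(P[|{ω | D0 ω = false}])
      = (∫ ω in C, Y0 ω ∂P) + ∫ ω in N, Y0 ω ∂P := by
    rw [← measureReal_union hCN (hD1s false), hCN_eq, measureReal_mul_integral_cond,
      setIntegral_union hCN (hD1s false) hY0.integrableOn hY0.integrableOn]
  have h1 : P.real N * ∫ ω, Y1 ω ∂(P[|N]) = ∫ ω in N, Y0 ω ∂P := by
    rw [← hexcl, measureReal_mul_integral_cond]
  have hlhs : ∫ ω, (Y1 ω - Y0 ω) ∂(P[|{ω | D0 ω = false} ∩ T])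
      = (P.real C)⁻¹ * ((∫ ω in C, Y1 ω ∂P) - ∫ ω in C, Y0 ω ∂P) := by
    rw [← integral_sub hY1.integrableOn hY0.integrableOn]
    exact integral_cond_eq P C _
  rw [hlhs, hcell0, hcell1, ← hY1C, ← measureReal_def, ← measureReal_def, h0, h1]
  ring
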